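/- arXiv:math/9912142 — 2 statements merged into one kernel-verified Lean document; each statement's English description precedes it below -/
import Mathlib

section
/- Define the triple sums S_A = Σ_{z1,z2,z3} (−1)^(z1+z2+z3) · [(g−h+k+z1)!(a+c−h+z1)!(2h−z1)! / (z1!(g+h−k−z1)!(c−a+h−z1)!)] · [(2d−z2)!(c−d+f+z2)! / (z2!(d−b+k−z2)!(c+d−f−z2)!(b+d+k+1−z2)!)] · [(b+e−a+z3)!(e−f+g+z3)! / (z3!(a+b−e−z3)!(f+g−e−z3)!(2e+1+z3)!)] · [(a+d−e+k−z2−z3)! / ((a−d+f−h+z1+z2)!(e−f−h+k+z1+z3)!)] and S_E = Σ_{z1,z2,z3} (−1)^(z2+z3) · [(k+g−h+z1)!(a+c−h+z1)!(2h−z1)! / (z1!(g+h−k−z1)!(c−a+h−z1)!)] · [(2d−z2)!(c−d+f+z2)! / (z2!(d−b+k−z2)!(c+d−f−z2)!(b+d+k+1−z2)!)] · [(2e−z3)! / (z3!(a−b+e−z3)!(e+f−g−z3)!(e+f+g+1−z3)!)] · [(a+d+e+k+1−z2−z3)!(e+f+h−k−z1−z3)! / ((a+b+e+1−z3)!(a−d+f−h+z1+z2)!)].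 Then, under the triangle conditions of the 9j symbol, (−1)^(c+h−a) · S_A = (−1)^(c−b+e−g+k) · S_E (both exponents are integers). This expresses the equality of the Ališauskas–Jucys triple-sum formula for the SU(2) 9j coefficient {a b e; c d f; h k g} and the new triple-sum formula obtained from expansion (trse) of the paper. -/
noncomputable section

/-- Factorial of a rational argument: `x!` when `x` is a nonnegative integer,
and `0` otherwise.  Terms of a sum containing a factorial with an invalid
argument are thereby omitted: in the numerator such a factor is `0`, and in the
denominator it produces a division by zero, which is `0` in `ℚ`. -/
def fct (x : ℚ) : ℚ :=
  if 0 ≤ x ∧ x.den = 1 then (Nat.factorial x.num.toNat : ℚ) else 0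

/-- `(-1)` raised to a rational exponent (an integer whenever it matters). -/
def neg1pw (x : ℚ) : ℚ := (-1 : ℚ) ^ x.num

/-- `x` is a nonnegative half-integer. -/
def IsNNHalfInt (x : ℚ) : Prop := 0 ≤ x ∧ ∃ m : ℤ, 2 * x = (m : ℚ)

/-- The triangle condition for the triad `(x, y, z)`: the linear combinations
`x+y-z`, `x-y+z` and `-x+y+z` are all nonnegative integers. -/
def Triad (x y z : ℚ) : Prop :=
  (∃ n : ℕ, x + y - z = (n : ℚ)) ∧ (∃ n : ℕ, x - y + z = (n : ℚ)) ∧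
    (∃ n : ℕ, -x + y + z = (n : ℚ))

/-- The square `N(x,y,z)` of the asymmetric triangle coefficient `∇[xyz]`. -/
def Nsq (x y z : ℚ) : ℚ :=
  fct (x + y - z) * fct (x - y + z) * fct (x + y + z + 1) / fct (y + z - x)

/-- The Ališauskas–Jucys triple sum `S_A` for the 9j coefficient. -/
def sumSA (a b c d e f g h k : ℚ) : ℚ :=
  ∑ᶠ z1 : ℕ, ∑ᶠ z2 : ℕ, ∑ᶠ z3 : ℕ,
    (-1 : ℚ) ^ (z1 + z2 + z3) *
      (fct (g - h + k + z1) * fct (a + c - h + z1) * fct (2 * h - z1) /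
        ((Nat.factorial z1 : ℚ) * fct (g + h - k - z1) * fct (c - a + h - z1))) *
      (fct (2 * d - z2) * fct (c - d + f + z2) /
        ((Nat.factorial z2 : ℚ) * fct (d - b + k - z2) * fct (c + d - f - z2) *
          fct (b + d + k + 1 - z2))) *
      (fct (b + e - a + z3) * fct (e - f + g + z3) /
        ((Nat.factorial z3 : ℚ) * fct (a + b - e - z3) * fct (f + g - e - z3) *
          fct (2 * e + 1 + z3))) *
      (fct (a + d - e + k - z2 - z3) /
        (fct (a - d + f - h + z1 + z2) * fct (e - f - h + k + z1 + z3)))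

/-- The triple sum `S_E` of the new triple-sum formula obtained from expansion
(trse) of the paper. -/
def sumSE (a b c d e f g h k : ℚ) : ℚ :=
  ∑ᶠ z1 : ℕ, ∑ᶠ z2 : ℕ, ∑ᶠ z3 : ℕ,
    (-1 : ℚ) ^ (z2 + z3) *
      (fct (k + g - h + z1) * fct (a + c - h + z1) * fct (2 * h - z1) /
        ((Nat.factorial z1 : ℚ) * fct (g + h - k - z1) * fct (c - a + h - z1))) *
      (fct (2 * d - z2) * fct (c - d + f + z2) /
        ((Nat.factorial z2 : ℚ) * fct (d - b + k - z2) * fct (c + d - f - z2) *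
          fct (b + d + k + 1 - z2))) *
      (fct (2 * e - z3) /
        ((Nat.factorial z3 : ℚ) * fct (a - b + e - z3) * fct (e + f - g - z3) *
          fct (e + f + g + 1 - z3))) *
      (fct (a + d + e + k + 1 - z2 - z3) * fct (e + f + h - k - z1 - z3) /
        (fct (a + b + e + 1 - z3) * fct (a - d + f - h + z1 + z2)))

section

open Finset Polynomial

/-- The factorial of an integer, with value `0` at negative arguments. -/
def zfact (n : ℤ) : ℚ := if 0 ≤ n then (n.toNat.factorial : ℚ) else 0

lemma zfact_of_neg {n : ℤ} (h : n < 0) : zfact n = 0 := by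
  simp [zfact, not_le.mpr h]

lemma zfact_ne_zero {n : ℤ} (h : 0 ≤ n) : zfact n ≠ 0 := by
  simp [zfact, h, Nat.factorial_ne_zero]

lemma zfact_zero : zfact 0 = 1 := by simp [zfact]

lemma zfact_natCast (n : ℕ) : zfact n = n.factorial := by simp [zfact]

lemma zfact_succ {n : ℤ} (h : 0 ≤ n) : zfact (n + 1) = (n + 1) * zfact n := by
  lift n to ℕ using h
  have : ((n : ℤ) + 1) = ((n + 1 : ℕ) : ℤ) := by push_cast; ring
  rw [this, zfact_natCast, zfact_natCast, Nat.factorial_succ]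
  push_cast
  ring

lemma fct_intCast (n : ℤ) : fct (n : ℚ) = zfact n := by
  simp [fct, zfact]

/-- A product of consecutive integers as a quotient of factorials. -/
lemma prod_Ioc_add {V U x : ℤ} (hVU : V ≤ U) (hx : 0 ≤ U + x) :
    ∏ i ∈ Ioc V U, ((i : ℚ) + x) = zfact (U + x) / zfact (V + x) := by
  by_cases hV : 0 ≤ V + x
  · clear hx
    induction U, hVU using Int.leInduction with
    | base => simp [zfact_ne_zero hV]
    | succ n hn ih =>
      have h1 : Ioc V (n + 1) = insert (n + 1) (Ioc V n) := by
        ext y; simp only [mem_Ioc, mem_insert]; omega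
      rw [h1, prod_insert (by simp), ih]
      have h2 : n + 1 + x = (n + x) + 1 := by ring
      rw [h2, zfact_succ (by omega)]
      push_cast
      ring
  · rw [zfact_of_neg (not_le.mp hV), div_zero]
    refine prod_eq_zero (i := -x) (by simp only [mem_Ioc]; omega) (by push_cast; ring)

lemma prod_Ioc_sub_eq_prod_Ioc_add (V U x : ℤ) :
    ∏ i ∈ Ioc V U, ((x : ℚ) - i) = ∏ i ∈ Ioc (-U - 1) (-V - 1), ((i : ℚ) + x) := by
  refine prod_nbij' (fun i => -i) (fun i => -i) ?_ ?_ ?_ ?_ ?_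
  · intro i hi; simp only [mem_Ioc] at hi ⊢; omega
  · intro i hi; simp only [mem_Ioc] at hi ⊢; omega
  · intro i _; simp
  · intro i _; simp
  · intro i _; push_cast; ring

lemma prod_Ioc_const_sub {V U x : ℤ} (hVU : V ≤ U) (hx : 0 ≤ x - V - 1) :
    ∏ i ∈ Ioc V U, ((x : ℚ) - i) = zfact (x - V - 1) / zfact (x - U - 1) := by
  rw [prod_Ioc_sub_eq_prod_Ioc_add, prod_Ioc_add (by omega) (by omega)]
  congr 2 <;> ring

lemma prod_Ioc_sub_const {V U x : ℤ} (hVU : V ≤ U) (hx : 0 ≤ U - x) :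
    ∏ i ∈ Ioc V U, ((i : ℚ) - x) = zfact (U - x) / zfact (V - x) := by
  have := prod_Ioc_add (x := -x) hVU (by omega)
  simpa [sub_eq_add_neg] using this

lemma prod_Ioc_sub_comm {V U : ℤ} (hVU : V ≤ U) (x : ℚ) :
    ∏ i ∈ Ioc V U, (x - i) = (-1) ^ (U - V) * ∏ i ∈ Ioc V U, ((i : ℚ) - x) := by
  have h : ∀ i ∈ Ioc V U, (x - i) = (-1) * ((i : ℚ) - x) := fun i _ => by ring
  rw [prod_congr rfl h, prod_mul_distrib, prod_const, Int.card_Ioc, ← zpow_natCast,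
    Int.toNat_of_nonneg (by omega)]

lemma prod_Ioc_erase_sub {A B x : ℤ} (hx : x ∈ Ioc A B) :
    ∏ i ∈ (Ioc A B).erase x, ((x : ℚ) - i) =
      (-1) ^ (B - x) * (zfact (x - A - 1) * zfact (B - x)) := by
  have hx' := mem_Ioc.mp hx
  have h1 : (Ioc A B).erase x = Ioc A (x - 1) ∪ Ioc x B := by
    ext y; simp only [mem_erase, mem_Ioc, mem_union]; omega
  have h2 : Disjoint (Ioc A (x - 1)) (Ioc x B) := by
    rw [disjoint_left]; intro y; simp only [mem_Ioc]; omega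
  rw [h1, prod_union h2, prod_Ioc_const_sub (by omega) (by omega),
    prod_Ioc_sub_comm hx'.2, prod_Ioc_sub_const hx'.2 (by omega)]
  have h3 : x - (x - 1) - 1 = 0 := by ring
  rw [h3, sub_self, zfact_zero]
  ring

/-- Divided differences of a polynomial of small degree vanish. -/
lemma sum_eval_div_prod_erase_eq_zero (s : Finset ℤ) (P : ℚ[X]) (h : P.natDegree + 1 < #s) :
    ∑ i ∈ s, P.eval (i : ℚ) / ∏ j ∈ s.erase i, ((i : ℚ) - j) = 0 := by
  rw [← Lagrange.coeff_eq_sum (v := fun i : ℤ => (i : ℚ)) (Int.cast_injective.injOn)]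
  · exact coeff_eq_zero_of_natDegree_lt (by omega)
  · refine lt_of_le_of_lt degree_le_natDegree ?_
    exact_mod_cast (by omega : P.natDegree < #s)

lemma sum_neg_one_zpow_eval_eq_zero {A B : ℤ} (P : ℚ[X]) (h : (P.natDegree : ℤ) < B - A) :
    ∑ x ∈ Icc A B, (-1 : ℚ) ^ x * P.eval (x : ℚ) / (zfact (x - A) * zfact (B - x)) = 0 := by
  have hs : Icc A B = Ioc (A - 1) B := by ext y; simp only [mem_Icc, mem_Ioc]; omega
  have h0 := sum_eval_div_prod_erase_eq_zero (Ioc (A - 1) B) P (by rw [Int.card_Ioc]; omega)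
  have key : ∑ x ∈ Icc A B, (-1 : ℚ) ^ x * P.eval (x : ℚ) / (zfact (x - A) * zfact (B - x)) =
      (-1) ^ B * ∑ i ∈ Ioc (A - 1) B,
        P.eval (i : ℚ) / ∏ j ∈ (Ioc (A - 1) B).erase i, ((i : ℚ) - j) := by
    rw [hs, mul_sum]
    refine sum_congr rfl fun x hx => ?_
    have e : (-1 : ℚ) ^ B = (-1) ^ (B - x) * (-1) ^ x := by
      rw [← zpow_add₀ (by norm_num)]; congr 1; ring
    have e2 : (-1 : ℚ) ^ (B - x) ≠ 0 := zpow_ne_zero _ (by norm_num)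
    rw [prod_Ioc_erase_sub hx, e, show x - (A - 1) - 1 = x - A by ring]
    field_simp
  rw [key, h0, mul_zero]

/-- The rising product `∏ (X + i)` over `V < i ≤ U`. -/
def risingProd (V U : ℤ) : ℚ[X] := ∏ i ∈ Ioc V U, (X + C (i : ℚ))

/-- The falling product `∏ (i - X)` over `V < i ≤ U`. -/
def fallingProd (V U : ℤ) : ℚ[X] := ∏ i ∈ Ioc V U, (C (i : ℚ) - X)

lemma natDegree_risingProd_le (V U : ℤ) : (risingProd V U).natDegree ≤ (U - V).toNat := by
  refine (natDegree_prod_le _ _).trans ?_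
  refine (sum_le_card_nsmul _ _ 1 fun i _ => ?_).trans (by simp)
  compute_degree

lemma natDegree_fallingProd_le (V U : ℤ) : (fallingProd V U).natDegree ≤ (U - V).toNat := by
  refine (natDegree_prod_le _ _).trans ?_
  refine (sum_le_card_nsmul _ _ 1 fun i _ => ?_).trans (by simp)
  compute_degree

lemma eval_risingProd (V U : ℤ) (x : ℚ) :
    (risingProd V U).eval x = ∏ i ∈ Ioc V U, ((i : ℚ) + x) := by
  simp [risingProd, eval_prod, add_comm]

lemma eval_fallingProd (V U : ℤ) (x : ℚ) :
    (fallingProd V U).eval x = ∏ i ∈ Ioc V U, ((i : ℚ) - x) := by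
  simp [fallingProd, eval_prod]

lemma sum_alternating_rising_eq_zero {A B C D E G H : ℤ} (hA : 0 ≤ A) (hB : 0 ≤ B)
    (hHA : H ≤ A) (hDC : D ≤ C) (hEC : E ≤ C) (hGB : G ≤ B)
    (hdeg : (A - H) + B + (C - D) < E + G) :
    ∑ x ∈ Icc 0 D, (-1 : ℚ) ^ x * (zfact (A + x) * zfact (B + x) * zfact (C - x) /
      (zfact x * zfact (D - x) * zfact (E - x) * zfact (G + x) * zfact (H + x))) = 0 := by
  have hd1 := natDegree_risingProd_le H A
  have hd2 := natDegree_risingProd_le 0 B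
  have hd3 := natDegree_fallingProd_le D C
  have hd : (risingProd H A * risingProd 0 B * fallingProd D C).natDegree ≤
      (A - H).toNat + (B - 0).toNat + (C - D).toNat :=
    natDegree_mul_le_of_le (natDegree_mul_le_of_le hd1 hd2) hd3
  rw [← sum_neg_one_zpow_eval_eq_zero (A := -G) (B := E)
    (risingProd H A * risingProd 0 B * fallingProd D C) (by omega)]
  refine sum_congr_of_eq_on_inter ?_ ?_ ?_
  · intro x hx hx'
    simp only [mem_Icc] at hx hx'
    rcases lt_or_ge (E - x) 0 with h | h
    · simp [zfact_of_neg h]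
    · simp [zfact_of_neg (show G + x < 0 by omega)]
  · intro x hx hx'
    simp only [mem_Icc] at hx hx'
    rw [eval_mul, eval_mul, eval_risingProd, eval_risingProd, eval_fallingProd]
    rcases lt_or_ge x 0 with h | h
    · rw [prod_Ioc_add hB (by omega), zfact_of_neg (n := 0 + x) (by omega)]
      simp
    · rw [prod_Ioc_sub_const hDC (by omega), zfact_of_neg (n := D - x) (by omega)]
      simp
  · intro x hx hx'
    simp only [mem_Icc] at hx hx'
    rw [eval_mul, eval_mul, eval_risingProd, eval_risingProd, eval_fallingProd,
      prod_Ioc_add hHA (by omega), prod_Ioc_add hB (by omega), prod_Ioc_sub_const hDC (by omega),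
      sub_neg_eq_add, zero_add, add_comm x G]
    simp only [div_eq_mul_inv, mul_inv]
    ring

lemma sum_alternating_falling_eq_zero {A C D E G K L : ℤ} (hA : 0 ≤ A)
    (hLK : L ≤ K) (hDK : D ≤ K) (hDC : D ≤ C) (hEC : E ≤ C) (hGA : G ≤ A)
    (hdeg : (C - D) + A + (K - L) < E + G) :
    ∑ x ∈ Icc 0 D, (-1 : ℚ) ^ x * (zfact (C - x) * zfact (A + x) * zfact (K - x) /
      (zfact x * zfact (D - x) * zfact (E - x) * zfact (L - x) * zfact (G + x))) = 0 := by
  have hd1 := natDegree_fallingProd_le D C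
  have hd2 := natDegree_risingProd_le 0 A
  have hd3 := natDegree_fallingProd_le L K
  have hd : (fallingProd D C * risingProd 0 A * fallingProd L K).natDegree ≤
      (C - D).toNat + (A - 0).toNat + (K - L).toNat :=
    natDegree_mul_le_of_le (natDegree_mul_le_of_le hd1 hd2) hd3
  rw [← sum_neg_one_zpow_eval_eq_zero (A := -G) (B := E)
    (fallingProd D C * risingProd 0 A * fallingProd L K) (by omega)]
  refine sum_congr_of_eq_on_inter ?_ ?_ ?_
  · intro x hx hx'
    simp only [mem_Icc] at hx hx'
    rcases lt_or_ge (E - x) 0 with h | h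
    · simp [zfact_of_neg h]
    · simp [zfact_of_neg (show G + x < 0 by omega)]
  · intro x hx hx'
    simp only [mem_Icc] at hx hx'
    rw [eval_mul, eval_mul, eval_risingProd, eval_fallingProd, eval_fallingProd]
    rcases lt_or_ge x 0 with h | h
    · rw [prod_Ioc_add hA (by omega), zfact_of_neg (n := 0 + x) (by omega)]
      simp
    · rw [prod_Ioc_sub_const hDC (by omega), zfact_of_neg (n := D - x) (by omega)]
      simp
  · intro x hx hx'
    simp only [mem_Icc] at hx hx'
    rw [eval_mul, eval_mul, eval_risingProd, eval_fallingProd, eval_fallingProd,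
      prod_Ioc_sub_const hDC (by omega), prod_Ioc_add hA (by omega),
      prod_Ioc_sub_const hLK (by omega),
      sub_neg_eq_add, zero_add, add_comm x G]
    simp only [div_eq_mul_inv, mul_inv]
    ring

lemma neg_one_zpow_sub_comm (m n : ℤ) : (-1 : ℚ) ^ (m - n) = (-1) ^ (n - m) := by
  rw [← neg_sub n m, zpow_neg, ← inv_zpow]
  norm_num

lemma prod_Ioc_div_prod_Ioc {M N x : ℤ} (hx : x ≤ N) :
    (∏ i ∈ Ioc M N, ((i : ℚ) - x)) / ∏ i ∈ Ioc N M, ((x : ℚ) - i) =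
      (-1) ^ (M - N).toNat * (zfact (N - x) / zfact (M - x)) := by
  rcases le_total M N with h | h
  · rw [Ioc_eq_empty_of_le h, prod_empty, div_one, prod_Ioc_sub_const h (by omega),
      Int.toNat_of_nonpos (by omega), pow_zero, one_mul]
  · rw [Ioc_eq_empty_of_le h, prod_empty, prod_Ioc_sub_comm h,
      prod_Ioc_sub_const h (by omega), ← zpow_natCast, Int.toNat_of_nonneg (by omega),
      one_div, mul_inv, inv_div, ← zpow_neg, neg_sub, neg_one_zpow_sub_comm]

/-- Three intervals of integers: the poles of the rational functions considered below. -/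
def poleSet (p₁ p₂ p₃ M N : ℤ) : Finset ℤ :=
  Ioc (-(p₂ + p₃ + 1) - 1) (-(p₃ + 1)) ∪ Ioc (-1) p₁ ∪ Ioc N M

lemma disjoint_left_middle {p₁ p₂ p₃ : ℤ} (hp₃ : 0 ≤ p₃) :
    Disjoint (Ioc (-(p₂ + p₃ + 1) - 1) (-(p₃ + 1))) (Ioc (-1) p₁) := by
  rw [disjoint_left]; intro y; simp only [mem_Ioc]; omega

lemma disjoint_left_middle_right {p₁ p₂ p₃ M N : ℤ} (hp₃ : 0 ≤ p₃) (hp₁ : 0 ≤ p₁) (hN : p₁ ≤ N) :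
    Disjoint (Ioc (-(p₂ + p₃ + 1) - 1) (-(p₃ + 1)) ∪ Ioc (-1) p₁) (Ioc N M) := by
  rw [disjoint_left]; intro y; simp only [mem_Ioc, mem_union]; omega

lemma prod_div_prod_erase_poleSet_middle {p₁ p₂ p₃ M N x : ℤ} (hp₂ : 0 ≤ p₂)
    (hp₃ : 0 ≤ p₃) (hN : p₁ ≤ N) (hx : 0 ≤ x) (hx₁ : x ≤ p₁) :
    (∏ i ∈ Ioc M N, ((i : ℚ) - x)) / ∏ j ∈ (poleSet p₁ p₂ p₃ M N).erase x, ((x : ℚ) - j) =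
      (-1) ^ p₁ * (-1) ^ (M - N).toNat * (-1) ^ x * (zfact (p₃ + x) * zfact (N - x) /
        (zfact x * zfact (p₁ - x) * zfact (M - x) * zfact (p₂ + p₃ + 1 + x))) := by
  have hE : (poleSet p₁ p₂ p₃ M N).erase x =
      Ioc (-(p₂ + p₃ + 1) - 1) (-(p₃ + 1)) ∪ (Ioc (-1) p₁).erase x ∪ Ioc N M := by
    ext y; simp only [poleSet, mem_Ioc, mem_union, mem_erase]; omega
  have ei (m : ℤ) : ((-1 : ℚ) ^ m)⁻¹ = (-1) ^ m := by rw [← inv_zpow]; norm_num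
  have e : (-1 : ℚ) ^ (p₁ - x) = (-1) ^ p₁ * (-1) ^ x := by
    rw [sub_eq_add_neg, zpow_add₀ (by norm_num), zpow_neg, ei]
  rw [hE, prod_union
      ((disjoint_left_middle_right hp₃ (hx.trans hx₁) hN).mono_left
        (union_subset_union_right (erase_subset _ _))),
    prod_union ((disjoint_left_middle hp₃).mono_right (erase_subset _ _)),
    ← one_mul (∏ i ∈ Ioc M N, ((i : ℚ) - x)), mul_div_mul_comm,
    prod_Ioc_div_prod_Ioc (hx₁.trans hN),
    prod_Ioc_const_sub (by omega) (by omega), prod_Ioc_erase_sub (by simp only [mem_Ioc]; omega),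
    show x - (-(p₂ + p₃ + 1) - 1) - 1 = p₂ + p₃ + 1 + x by ring,
    show x - -(p₃ + 1) - 1 = p₃ + x by ring, show x - -1 - 1 = x by ring]
  simp only [div_eq_mul_inv, mul_inv, inv_inv, ei, e]
  ring

lemma prod_div_prod_erase_poleSet_left {p₁ p₂ p₃ M N z x : ℤ} (hp₁ : 0 ≤ p₁)
    (hp₃ : 0 ≤ p₃) (hN : p₁ ≤ N) (hz : 0 ≤ z) (hz₂ : z ≤ p₂) (hx : x = z - (p₂ + p₃ + 1)) :
    (∏ i ∈ Ioc M N, ((i : ℚ) - x)) / ∏ j ∈ (poleSet p₁ p₂ p₃ M N).erase x, ((x : ℚ) - j) =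
      -((-1) ^ p₁ * (-1) ^ (M - N).toNat * (-1) ^ (p₂ + z) *
        (zfact (p₂ + p₃ - z) * zfact (N + p₂ + p₃ + 1 - z) /
          (zfact z * zfact (p₂ - z) * zfact (M + p₂ + p₃ + 1 - z) *
            zfact (p₁ + p₂ + p₃ + 1 - z)))) := by
  have hE : (poleSet p₁ p₂ p₃ M N).erase x =
      (Ioc (-(p₂ + p₃ + 1) - 1) (-(p₃ + 1))).erase x ∪ Ioc (-1) p₁ ∪ Ioc N M := by
    ext y; simp only [poleSet, mem_Ioc, mem_union, mem_erase]; omega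
  have ei (m : ℤ) : ((-1 : ℚ) ^ m)⁻¹ = (-1) ^ m := by rw [← inv_zpow]; norm_num
  have e : (-1 : ℚ) ^ (p₂ - z) = (-1) ^ (p₂ + z) := by
    rw [sub_eq_add_neg, zpow_add₀ (by norm_num), zpow_add₀ (by norm_num), zpow_neg, ei]
  rw [hE, prod_union
      ((disjoint_left_middle_right hp₃ hp₁ hN).mono_left
        (union_subset_union_left (erase_subset _ _))),
    prod_union ((disjoint_left_middle hp₃).mono_left (erase_subset _ _)),
    ← one_mul (∏ i ∈ Ioc M N, ((i : ℚ) - x)), mul_div_mul_comm,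
    prod_Ioc_div_prod_Ioc (by omega),
    prod_Ioc_erase_sub (by simp only [mem_Ioc]; omega), prod_Ioc_sub_comm (by omega),
    prod_Ioc_sub_const (by omega) (by omega),
    show x - (-(p₂ + p₃ + 1) - 1) - 1 = z by omega,
    show -(p₃ + 1) - x = p₂ - z by omega, show N - x = N + p₂ + p₃ + 1 - z by omega,
    show M - x = M + p₂ + p₃ + 1 - z by omega, show p₁ - x = p₁ + p₂ + p₃ + 1 - z by omega,
    show -1 - x = p₂ + p₃ - z by omega, sub_neg_eq_add, zpow_add_one₀ (by norm_num)]
  simp only [div_eq_mul_inv, mul_inv, inv_inv, ei, e]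
  ring

/-- The vanishing of the sum of the residues of a rational function whose poles lie in three
intervals of integers. -/
lemma exists_sum_eq_sum_reflected_add {p₁ p₂ p₃ U M N : ℤ} (hp₁ : 0 ≤ p₁) (hp₂ : 0 ≤ p₂)
    (hp₃ : 0 ≤ p₃) (hU : 0 ≤ U) (hN : p₁ ≤ N) :
    ∃ c : ℤ → ℚ, ∀ V : ℤ, V ≤ U → (U - V) + (N - M) < p₁ + p₂ + 1 →
      ∑ x ∈ Icc 0 p₁, (-1 : ℚ) ^ x * (zfact (p₃ + x) * zfact (U + x) * zfact (N - x) /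
        (zfact x * zfact (p₁ - x) * zfact (M - x) * zfact (p₂ + p₃ + 1 + x) * zfact (V + x))) =
      ∑ z ∈ Icc 0 p₂, (-1 : ℚ) ^ (p₂ + z) * ((∏ i ∈ Ioc V U, ((i : ℚ) + (z - (p₂ + p₃ + 1)))) *
        (zfact (p₂ + p₃ - z) * zfact (N + p₂ + p₃ + 1 - z) /
          (zfact z * zfact (p₂ - z) * zfact (M + p₂ + p₃ + 1 - z) *
            zfact (p₁ + p₂ + p₃ + 1 - z)))) +
      ∑ x ∈ Ioc N M, c x * (zfact (U + x) / zfact (V + x)) := by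
  obtain ⟨s, hs⟩ : ∃ s, s = poleSet p₁ p₂ p₃ M N := ⟨_, rfl⟩
  obtain ⟨ε, hε⟩ : ∃ ε : ℚ, ε = (-1) ^ p₁ * (-1) ^ (M - N).toNat := ⟨_, rfl⟩
  have hε2 : ε * ε = 1 := by
    rw [hε, mul_mul_mul_comm, ← mul_zpow, ← mul_pow]; norm_num
  refine ⟨fun x => -ε * ((∏ i ∈ Ioc M N, ((i : ℚ) - x)) / ∏ j ∈ s.erase x, ((x : ℚ) - j)), ?_⟩
  intro V hV hdeg
  have d₁₂ := disjoint_left_middle (p₁ := p₁) (p₂ := p₂) hp₃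
  have d₃ := disjoint_left_middle_right (p₂ := p₂) (M := M) hp₃ hp₁ hN
  have hd : (risingProd V U * fallingProd M N).natDegree ≤ (U - V).toNat + (N - M).toNat :=
    natDegree_mul_le_of_le (natDegree_risingProd_le _ _) (natDegree_fallingProd_le _ _)
  have hcard : #s = (p₂ + 1).toNat + (p₁ + 1).toNat + (M - N).toNat := by
    rw [hs, poleSet, card_union_of_disjoint d₃, card_union_of_disjoint d₁₂]
    simp only [Int.card_Ioc]
    congr 3
    ring
  have h0 := sum_eval_div_prod_erase_eq_zero s (risingProd V U * fallingProd M N) (by omega)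
  have hsplit (f : ℤ → ℚ) : ∑ x ∈ s, f x = ∑ z ∈ Icc 0 p₂, f (z - (p₂ + p₃ + 1)) +
      ∑ x ∈ Icc 0 p₁, f x + ∑ x ∈ Ioc N M, f x := by
    rw [hs, poleSet, sum_union d₃, sum_union d₁₂]
    congr 2
    · refine sum_nbij' (fun x => x + (p₂ + p₃ + 1)) (fun z => z - (p₂ + p₃ + 1)) ?_ ?_ ?_ ?_ ?_
      · intro z hz; simp only [mem_Icc, mem_Ioc] at hz ⊢; omega
      · intro z hz; simp only [mem_Icc, mem_Ioc] at hz ⊢; omega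
      · intro z _; ring
      · intro z _; ring
      · intro z _; simp
    · exact sum_congr (by ext y; simp only [mem_Icc, mem_Ioc]; omega) fun _ _ => rfl
  have e₁ : ∑ z ∈ Icc 0 p₂, (-1 : ℚ) ^ (p₂ + z) *
      ((∏ i ∈ Ioc V U, ((i : ℚ) + (z - (p₂ + p₃ + 1)))) *
        (zfact (p₂ + p₃ - z) * zfact (N + p₂ + p₃ + 1 - z) /
          (zfact z * zfact (p₂ - z) * zfact (M + p₂ + p₃ + 1 - z) *
            zfact (p₁ + p₂ + p₃ + 1 - z)))) =
      ∑ z ∈ Icc 0 p₂, -ε * ((risingProd V U * fallingProd M N).eval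
        ((z - (p₂ + p₃ + 1) : ℤ) : ℚ) / ∏ j ∈ s.erase (z - (p₂ + p₃ + 1)),
          (((z - (p₂ + p₃ + 1) : ℤ) : ℚ) - j)) := by
    refine sum_congr rfl fun z hz => ?_
    have hz' := mem_Icc.mp hz
    rw [eval_mul, eval_risingProd, eval_fallingProd, mul_div_assoc (∏ i ∈ Ioc V U, _), hs,
      prod_div_prod_erase_poleSet_left hp₁ hp₃ hN hz'.1 hz'.2 rfl, ← hε]
    push_cast
    linear_combination (-1 : ℚ) * ((-1 : ℚ) ^ (p₂ + z) *
      ((∏ i ∈ Ioc V U, ((i : ℚ) + (z - (p₂ + p₃ + 1)))) *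
        (zfact (p₂ + p₃ - z) * zfact (N + p₂ + p₃ + 1 - z) /
          (zfact z * zfact (p₂ - z) * zfact (M + p₂ + p₃ + 1 - z) *
            zfact (p₁ + p₂ + p₃ + 1 - z))))) * hε2
  have e₂ : ∑ x ∈ Icc 0 p₁, (-1 : ℚ) ^ x * (zfact (p₃ + x) * zfact (U + x) * zfact (N - x) /
        (zfact x * zfact (p₁ - x) * zfact (M - x) * zfact (p₂ + p₃ + 1 + x) * zfact (V + x))) =
      ∑ x ∈ Icc 0 p₁, ε * ((risingProd V U * fallingProd M N).eval (x : ℚ) /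
        ∏ j ∈ s.erase x, ((x : ℚ) - j)) := by
    refine sum_congr rfl fun x hx => ?_
    have hx' := mem_Icc.mp hx
    rw [eval_mul, eval_risingProd, eval_fallingProd, mul_div_assoc (∏ i ∈ Ioc V U, _), hs,
      prod_div_prod_erase_poleSet_middle hp₂ hp₃ hN hx'.1 hx'.2, ← hε,
      prod_Ioc_add hV (by omega)]
    simp only [div_eq_mul_inv, mul_inv]
    linear_combination (-1 : ℚ) * ((-1 : ℚ) ^ x *
      (zfact (p₃ + x) * zfact (U + x) * zfact (N - x) * ((zfact x)⁻¹ * (zfact (p₁ - x))⁻¹ *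
        (zfact (M - x))⁻¹ * (zfact (p₂ + p₃ + 1 + x))⁻¹ * (zfact (V + x))⁻¹))) * hε2
  have e₃ : ∑ x ∈ Ioc N M, (-ε * ((∏ i ∈ Ioc M N, ((i : ℚ) - x)) /
        ∏ j ∈ s.erase x, ((x : ℚ) - j))) * (zfact (U + x) / zfact (V + x)) =
      ∑ x ∈ Ioc N M, -ε * ((risingProd V U * fallingProd M N).eval (x : ℚ) /
        ∏ j ∈ s.erase x, ((x : ℚ) - j)) := by
    refine sum_congr rfl fun x hx => ?_
    have hx' := mem_Ioc.mp hx
    rw [eval_mul, eval_risingProd, eval_fallingProd, prod_Ioc_add hV (by omega)]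
    ring
  rw [hsplit] at h0
  simp only [e₁, e₂, e₃, ← mul_sum]
  linear_combination ε * h0

lemma prod_Ioc_add_reflect {V U x : ℤ} (hVU : V ≤ U) (hx : 0 ≤ -x - V - 1) :
    ∏ i ∈ Ioc V U, ((i : ℚ) + x) = (-1) ^ (U - V) * (zfact (-x - V - 1) / zfact (-x - U - 1)) := by
  have h := prod_Ioc_sub_comm hVU (-(x : ℚ))
  have h2 := prod_Ioc_const_sub (x := -x) hVU hx
  push_cast at h2
  rw [h2] at h
  simp only [sub_neg_eq_add] at h
  rw [h, ← mul_assoc, ← mul_zpow]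
  norm_num

/-- The transformation of triple sums, for weights whose partial sums kill the extra residues. -/
lemma sum_sum_sum_eq_of_weights {p₁ p₂ p₃ w₁ w₂ w₃ r₂ u₃ m : ℤ} (hp₁ : 0 ≤ p₁) (hp₂ : 0 ≤ p₂)
    (hp₃ : 0 ≤ p₃) (hw₂ : 0 ≤ w₂) (hw : w₁ + w₂ = p₂ + p₃) (hm : r₂ + u₃ + m = w₃ + p₂)
    (f₁ f₂ : ℤ → ℚ)
    (hX : ∀ z₂ ∈ Icc 0 u₃, ∀ x, p₁ + u₃ - z₂ < x → x ≤ w₃ →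
      f₂ z₂ * ∑ z₁ ∈ Icc 0 r₂, (-1 : ℚ) ^ z₁ *
        (f₁ z₁ * zfact (w₂ + x) / (zfact (m + z₁ + z₂) * zfact (w₂ - r₂ + z₁ + x))) = 0)
    (hY : ∀ z₁ ∈ Icc 0 r₂, ∀ z, w₁ + r₂ - z₁ < z → z ≤ p₂ →
      f₁ z₁ * ∑ z₂ ∈ Icc 0 u₃, (-1 : ℚ) ^ z₂ *
        (f₂ z₂ * zfact (p₁ + p₂ + p₃ + u₃ + 1 - z₂ - z) / zfact (m + z₁ + z₂)) = 0) :
    ∑ z₁ ∈ Icc 0 r₂, ∑ z₂ ∈ Icc 0 u₃, ∑ z₃ ∈ Icc 0 p₁, (-1 : ℚ) ^ (z₁ + z₂ + z₃) * f₁ z₁ * f₂ z₂ *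
        (zfact (p₃ + z₃) * zfact (w₂ + z₃) /
          (zfact z₃ * zfact (p₁ - z₃) * zfact (w₃ - z₃) * zfact (p₂ + p₃ + 1 + z₃))) *
        (zfact (p₁ + u₃ - z₂ - z₃) / (zfact (m + z₁ + z₂) * zfact (w₂ - r₂ + z₁ + z₃))) =
    (-1) ^ (p₂ + r₂) * ∑ z₁ ∈ Icc 0 r₂, ∑ z₂ ∈ Icc 0 u₃, ∑ z₃ ∈ Icc 0 p₂,
        (-1 : ℚ) ^ (z₂ + z₃) * f₁ z₁ * f₂ z₂ *
        (zfact (p₂ + p₃ - z₃) /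
          (zfact z₃ * zfact (p₂ - z₃) * zfact (w₁ - z₃) * zfact (w₁ + w₂ + w₃ + 1 - z₃))) *
        (zfact (p₁ + p₂ + p₃ + u₃ + 1 - z₂ - z₃) * zfact (w₁ + r₂ - z₁ - z₃) /
          (zfact (p₁ + p₂ + p₃ + 1 - z₃) * zfact (m + z₁ + z₂))) := by
  have hc : ∀ z₂ : ℤ, ∃ c : ℤ → ℚ, z₂ ≤ u₃ → ∀ V : ℤ, V ≤ w₂ →
      (w₂ - V) + (p₁ + u₃ - z₂ - w₃) < p₁ + p₂ + 1 →
      ∑ x ∈ Icc 0 p₁, (-1 : ℚ) ^ x * (zfact (p₃ + x) * zfact (w₂ + x) * zfact (p₁ + u₃ - z₂ - x) /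
        (zfact x * zfact (p₁ - x) * zfact (w₃ - x) * zfact (p₂ + p₃ + 1 + x) * zfact (V + x))) =
      ∑ z ∈ Icc 0 p₂, (-1 : ℚ) ^ (p₂ + z) * ((∏ i ∈ Ioc V w₂, ((i : ℚ) + (z - (p₂ + p₃ + 1)))) *
        (zfact (p₂ + p₃ - z) * zfact (p₁ + u₃ - z₂ + p₂ + p₃ + 1 - z) /
          (zfact z * zfact (p₂ - z) * zfact (w₃ + p₂ + p₃ + 1 - z) *
            zfact (p₁ + p₂ + p₃ + 1 - z)))) +
      ∑ x ∈ Ioc (p₁ + u₃ - z₂) w₃, c x * (zfact (w₂ + x) / zfact (V + x)) := by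
    intro z₂
    by_cases h : z₂ ≤ u₃
    · obtain ⟨c, hc⟩ := exists_sum_eq_sum_reflected_add (M := w₃) hp₁ hp₂ hp₃ hw₂
        (show p₁ ≤ p₁ + u₃ - z₂ by omega)
      exact ⟨c, fun _ => hc⟩
    · exact ⟨0, fun h' => absurd h' h⟩
  choose c hc using hc
  let D : ℤ → ℤ → ℚ := fun z₁ z => if w₁ + r₂ - z₁ < z then
    (-1) ^ (p₂ + z) * (-1) ^ z₁ * ((∏ i ∈ Ioc (w₂ - r₂ + z₁) w₂, ((i : ℚ) + (z - (p₂ + p₃ + 1)))) *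
      (zfact (p₂ + p₃ - z) / (zfact z * zfact (p₂ - z) * zfact (w₁ + w₂ + w₃ + 1 - z) *
        zfact (p₁ + p₂ + p₃ + 1 - z)))) else 0
  have key : ∀ z₁ ∈ Icc 0 r₂, ∀ z₂ ∈ Icc 0 u₃,
      ∑ z₃ ∈ Icc 0 p₁, (-1 : ℚ) ^ (z₁ + z₂ + z₃) * f₁ z₁ * f₂ z₂ *
        (zfact (p₃ + z₃) * zfact (w₂ + z₃) /
          (zfact z₃ * zfact (p₁ - z₃) * zfact (w₃ - z₃) * zfact (p₂ + p₃ + 1 + z₃))) *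
        (zfact (p₁ + u₃ - z₂ - z₃) / (zfact (m + z₁ + z₂) * zfact (w₂ - r₂ + z₁ + z₃))) =
      (-1) ^ (p₂ + r₂) * ∑ z₃ ∈ Icc 0 p₂,
        (-1 : ℚ) ^ (z₂ + z₃) * f₁ z₁ * f₂ z₂ *
        (zfact (p₂ + p₃ - z₃) /
          (zfact z₃ * zfact (p₂ - z₃) * zfact (w₁ - z₃) * zfact (w₁ + w₂ + w₃ + 1 - z₃))) *
        (zfact (p₁ + p₂ + p₃ + u₃ + 1 - z₂ - z₃) * zfact (w₁ + r₂ - z₁ - z₃) /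
          (zfact (p₁ + p₂ + p₃ + 1 - z₃) * zfact (m + z₁ + z₂))) +
      ∑ z ∈ Icc 0 p₂, D z₁ z * (f₁ z₁ * ((-1 : ℚ) ^ z₂ *
        (f₂ z₂ * zfact (p₁ + p₂ + p₃ + u₃ + 1 - z₂ - z) / zfact (m + z₁ + z₂)))) +
      ∑ x ∈ Ioc (p₁ + u₃ - z₂) w₃, (-1 : ℚ) ^ z₂ * c z₂ x * (f₂ z₂ * ((-1 : ℚ) ^ z₁ *
        (f₁ z₁ * zfact (w₂ + x) / (zfact (m + z₁ + z₂) * zfact (w₂ - r₂ + z₁ + x))))) := by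
    intro z₁ hz₁ z₂ hz₂
    rw [mem_Icc] at hz₁ hz₂
    rcases lt_or_ge (m + z₁ + z₂) 0 with hneg | hpos
    · simp [zfact_of_neg hneg]
    have h := hc z₂ hz₂.2 (w₂ - r₂ + z₁) (by omega) (by omega)
    have hA : ∑ z₃ ∈ Icc 0 p₁, (-1 : ℚ) ^ (z₁ + z₂ + z₃) * f₁ z₁ * f₂ z₂ *
        (zfact (p₃ + z₃) * zfact (w₂ + z₃) /
          (zfact z₃ * zfact (p₁ - z₃) * zfact (w₃ - z₃) * zfact (p₂ + p₃ + 1 + z₃))) *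
        (zfact (p₁ + u₃ - z₂ - z₃) / (zfact (m + z₁ + z₂) * zfact (w₂ - r₂ + z₁ + z₃))) =
        ((-1) ^ z₁ * (-1) ^ z₂ * f₁ z₁ * f₂ z₂ / zfact (m + z₁ + z₂)) *
        ∑ x ∈ Icc 0 p₁, (-1 : ℚ) ^ x *
          (zfact (p₃ + x) * zfact (w₂ + x) * zfact (p₁ + u₃ - z₂ - x) /
          (zfact x * zfact (p₁ - x) * zfact (w₃ - x) * zfact (p₂ + p₃ + 1 + x) *
            zfact (w₂ - r₂ + z₁ + x))) := by
      rw [mul_sum]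
      refine sum_congr rfl fun x _ => ?_
      rw [zpow_add₀ (by norm_num), zpow_add₀ (by norm_num)]
      simp only [div_eq_mul_inv, mul_inv]
      ring
    rw [hA, h, mul_add, mul_sum, mul_sum, mul_sum, ← sum_add_distrib]
    congr 1
    · refine sum_congr rfl fun z hz => ?_
      rw [mem_Icc] at hz
      rw [show p₁ + u₃ - z₂ + p₂ + p₃ + 1 - z = p₁ + p₂ + p₃ + u₃ + 1 - z₂ - z by ring,
        show w₃ + p₂ + p₃ + 1 - z = w₁ + w₂ + w₃ + 1 - z by omega]
      simp only [D]
      split_ifs with hlt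
      · rw [zfact_of_neg (n := w₁ + r₂ - z₁ - z) (by omega)]
        simp only [div_eq_mul_inv, mul_inv]
        ring
      · have hpr := prod_Ioc_add_reflect (V := w₂ - r₂ + z₁) (U := w₂) (x := z - (p₂ + p₃ + 1))
          (by omega) (by omega)
        push_cast at hpr
        have ei (n : ℤ) : ((-1 : ℚ) ^ n)⁻¹ = (-1) ^ n := by rw [← inv_zpow]; norm_num
        have es (n : ℤ) : ((-1 : ℚ) ^ n) * (-1) ^ n = 1 := by rw [← mul_zpow]; norm_num
        have e1 : (-1 : ℚ) ^ (w₂ - (w₂ - r₂ + z₁)) = (-1) ^ r₂ * (-1) ^ z₁ := by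
          rw [show w₂ - (w₂ - r₂ + z₁) = r₂ + -z₁ by ring, zpow_add₀ (by norm_num), zpow_neg, ei]
        rw [hpr, e1, show -(z - (p₂ + p₃ + 1)) - (w₂ - r₂ + z₁) - 1 = w₁ + r₂ - z₁ - z by omega,
          show -(z - (p₂ + p₃ + 1)) - w₂ - 1 = w₁ - z by omega, zpow_add₀ (by norm_num) p₂ z,
          zpow_add₀ (by norm_num) p₂ r₂, zpow_add₀ (by norm_num) z₂ z]
        simp only [div_eq_mul_inv, mul_inv]
        generalize zfact (p₂ + p₃ - z) = y₁
        generalize zfact (p₁ + p₂ + p₃ + u₃ + 1 - z₂ - z) = y₂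
        generalize zfact (w₁ + r₂ - z₁ - z) = y₃
        generalize (zfact (m + z₁ + z₂))⁻¹ = y₄
        generalize (zfact (w₁ + w₂ + w₃ + 1 - z))⁻¹ = y₅
        generalize (zfact (p₁ + p₂ + p₃ + 1 - z))⁻¹ = y₆
        linear_combination ((-1 : ℚ) ^ p₂ * (-1) ^ r₂ * (-1) ^ z₂ * (-1) ^ z * f₁ z₁ * f₂ z₂ *
          y₁ * y₂ * y₃ * y₄ * y₅ * y₆ * (zfact z)⁻¹ * (zfact (p₂ - z))⁻¹ * (zfact (w₁ - z))⁻¹) *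
          es z₁
    · refine sum_congr rfl fun x _ => ?_
      simp only [div_eq_mul_inv, mul_inv]
      ring
  rw [sum_congr rfl fun z₁ hz₁ => sum_congr rfl (key z₁ hz₁)]
  simp only [sum_add_distrib, ← mul_sum]
  have hB : ∑ z₁ ∈ Icc 0 r₂, ∑ z₂ ∈ Icc 0 u₃, ∑ z ∈ Icc 0 p₂, D z₁ z * (f₁ z₁ * ((-1 : ℚ) ^ z₂ *
        (f₂ z₂ * zfact (p₁ + p₂ + p₃ + u₃ + 1 - z₂ - z) / zfact (m + z₁ + z₂)))) = 0 := by
    refine sum_eq_zero fun z₁ hz₁ => ?_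
    rw [sum_comm]
    refine sum_eq_zero fun z hz => ?_
    rw [← mul_sum, ← mul_sum]
    by_cases hlt : w₁ + r₂ - z₁ < z
    · rw [hY z₁ hz₁ z hlt (mem_Icc.mp hz).2, mul_zero]
    · simp [D, hlt]
  have hC : ∑ z₁ ∈ Icc 0 r₂, ∑ z₂ ∈ Icc 0 u₃, ∑ x ∈ Ioc (p₁ + u₃ - z₂) w₃,
      (-1 : ℚ) ^ z₂ * c z₂ x * (f₂ z₂ * ((-1 : ℚ) ^ z₁ *
        (f₁ z₁ * zfact (w₂ + x) / (zfact (m + z₁ + z₂) * zfact (w₂ - r₂ + z₁ + x))))) = 0 := by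
    rw [sum_comm]
    refine sum_eq_zero fun z₂ hz₂ => ?_
    rw [sum_comm]
    refine sum_eq_zero fun x hx => ?_
    rw [← mul_sum, ← mul_sum, hX z₂ hz₂ x (mem_Ioc.mp hx).1 (mem_Ioc.mp hx).2, mul_zero]
  rw [hB, hC, add_zero, add_zero]

lemma finsum_natCast_eq_sum_Icc {f : ℕ → ℚ} (F : ℤ → ℚ) (n : ℕ) (hf : ∀ z : ℕ, f z = F z)
    (hF : ∀ z : ℤ, n < z → F z = 0) : ∑ᶠ z : ℕ, f z = ∑ z ∈ Icc (0 : ℤ) n, F z := by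
  rw [finsum_eq_sum_of_support_subset (s := range (n + 1))]
  · refine sum_nbij' (fun z => (z : ℤ)) Int.toNat ?_ ?_ ?_ ?_ ?_
    · intro z hz; simp only [mem_Icc, mem_range] at hz ⊢; omega
    · intro z hz; simp only [mem_Icc, mem_range] at hz ⊢; omega
    · intro z _; simp
    · intro z hz; simp only [mem_Icc] at hz; omega
    · intro z _; exact hf z
  · intro z hz
    by_contra h
    simp only [coe_range, Set.mem_Iio, not_lt] at h
    exact hz (by rw [hf, hF z (by omega)])

lemma fct_eq_zfact {x : ℚ} (n : ℤ) (h : x = n) : fct x = zfact n := by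
  rw [h, fct_intCast]

/-- The factor of the summand depending on the first summation index only. -/
def weightFst (r₂ r₃ s₁ s₂ s₃ z : ℤ) : ℚ :=
  zfact (r₃ + z) * zfact (s₁ + z) * zfact (s₂ + s₃ - z) /
    (zfact z * zfact (r₂ - z) * zfact (s₃ - z))

/-- The factor of the summand depending on the second summation index only. -/
def weightSnd (q₁ q₂ q₃ u₁ u₂ u₃ z : ℤ) : ℚ :=
  zfact (q₁ + q₃ - z) * zfact (q₂ + z) /
    (zfact z * zfact (u₃ - z) * zfact (q₁ - z) * zfact (u₁ + u₂ + u₃ + 1 - z))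

lemma sum_sum_sum_weight_eq {p₁ p₂ p₃ q₁ q₂ q₃ r₁ r₂ r₃ s₁ s₂ s₃ u₁ u₂ u₃ w₁ w₂ w₃ : ℕ}
    (ea : p₁ + p₂ = s₁ + s₂) (eb : p₁ + p₃ = u₁ + u₂) (ec : q₁ + q₂ = s₁ + s₃)
    (ed : q₁ + q₃ = u₁ + u₃) (ee : p₂ + p₃ = w₁ + w₂) (ef : q₂ + q₃ = w₁ + w₃)
    (eg : r₂ + r₃ = w₂ + w₃) (eh : r₁ + r₂ = s₂ + s₃) (ek : r₁ + r₃ = u₂ + u₃) :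
    ∑ z₁ ∈ Icc (0 : ℤ) r₂, ∑ z₂ ∈ Icc (0 : ℤ) u₃, ∑ z₃ ∈ Icc (0 : ℤ) p₁,
        (-1 : ℚ) ^ (z₁ + z₂ + z₃) * weightFst r₂ r₃ s₁ s₂ s₃ z₁ *
        weightSnd q₁ q₂ q₃ u₁ u₂ u₃ z₂ *
        (zfact (p₃ + z₃) * zfact (w₂ + z₃) /
          (zfact z₃ * zfact (p₁ - z₃) * zfact (w₃ - z₃) * zfact (p₂ + p₃ + 1 + z₃))) *
        (zfact (p₁ + u₃ - z₂ - z₃) /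
          (zfact (s₁ - q₁ + z₁ + z₂) * zfact (w₂ - r₂ + z₁ + z₃))) =
    (-1) ^ ((p₂ : ℤ) + r₂) *
      ∑ z₁ ∈ Icc (0 : ℤ) r₂, ∑ z₂ ∈ Icc (0 : ℤ) u₃, ∑ z₃ ∈ Icc (0 : ℤ) p₂,
        (-1 : ℚ) ^ (z₂ + z₃) * weightFst r₂ r₃ s₁ s₂ s₃ z₁ *
        weightSnd q₁ q₂ q₃ u₁ u₂ u₃ z₂ *
        (zfact (p₂ + p₃ - z₃) /
          (zfact z₃ * zfact (p₂ - z₃) * zfact (w₁ - z₃) * zfact (w₁ + w₂ + w₃ + 1 - z₃))) *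
        (zfact (p₁ + p₂ + p₃ + u₃ + 1 - z₂ - z₃) * zfact (w₁ + r₂ - z₁ - z₃) /
          (zfact (p₁ + p₂ + p₃ + 1 - z₃) * zfact (s₁ - q₁ + z₁ + z₂))) := by
  refine sum_sum_sum_eq_of_weights (by omega) (by omega) (by omega) (by omega) (by omega)
    (by omega) _ _ ?_ ?_
  · intro z₂ hz₂ x hx hxw
    rw [mem_Icc] at hz₂
    rcases lt_or_ge (q₁ - z₂) 0 with hq | hq
    · simp [weightSnd, zfact_of_neg hq]
    have key := sum_alternating_rising_eq_zero (A := r₃) (B := s₁) (C := s₂ + s₃) (D := r₂)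
      (E := s₃) (G := s₁ - q₁ + z₂) (H := w₂ - r₂ + x) (by omega) (by omega) (by omega) (by omega)
      (by omega) (by omega) (by omega)
    have hsum : ∑ z₁ ∈ Icc (0 : ℤ) r₂, (-1 : ℚ) ^ z₁ *
        (weightFst r₂ r₃ s₁ s₂ s₃ z₁ * zfact (w₂ + x) /
          (zfact (s₁ - q₁ + z₁ + z₂) * zfact (w₂ - r₂ + z₁ + x))) = zfact (w₂ + x) * 0 := by
      rw [← key, mul_sum]
      refine sum_congr rfl fun z₁ _ => ?_
      rw [add_right_comm _ z₁ z₂, add_right_comm _ z₁ x]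
      simp only [weightFst, div_eq_mul_inv, mul_inv]
      ring
    rw [hsum, mul_zero, mul_zero]
  · intro z₁ hz₁ z hz hzp
    rw [mem_Icc] at hz₁
    rcases lt_or_ge (s₃ - z₁) 0 with hs | hs
    · simp [weightFst, zfact_of_neg hs]
    have key := sum_alternating_falling_eq_zero (A := q₂) (C := q₁ + q₃) (D := u₃) (E := q₁)
      (G := s₁ - q₁ + z₁) (K := p₁ + p₂ + p₃ + u₃ + 1 - z) (L := u₁ + u₂ + u₃ + 1) (by omega)
      (by omega) (by omega) (by omega) (by omega) (by omega) (by omega)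
    have hsum : ∑ z₂ ∈ Icc (0 : ℤ) u₃, (-1 : ℚ) ^ z₂ *
        (weightSnd q₁ q₂ q₃ u₁ u₂ u₃ z₂ * zfact (p₁ + p₂ + p₃ + u₃ + 1 - z₂ - z) /
          zfact (s₁ - q₁ + z₁ + z₂)) = 0 := by
      rw [← key]
      refine sum_congr rfl fun z₂ _ => ?_
      rw [sub_right_comm _ z₂ z]
      simp only [weightSnd, div_eq_mul_inv, mul_inv]
      ring
    rw [hsum, mul_zero]

lemma weightFst_natCast {a c g h k : ℚ} {r₂ r₃ s₁ s₂ s₃ : ℕ}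
    (hr₂ : h - k + g = r₂) (hr₃ : -h + k + g = r₃) (hs₁ : a + c - h = s₁) (hs₂ : a - c + h = s₂)
    (hs₃ : -a + c + h = s₃) (z : ℕ) :
    fct (g - h + k + z) * fct (a + c - h + z) * fct (2 * h - z) /
        ((Nat.factorial z : ℚ) * fct (g + h - k - z) * fct (c - a + h - z)) =
      weightFst r₂ r₃ s₁ s₂ s₃ z := by
  rw [weightFst]
  rw [fct_eq_zfact (x := g - h + k + z) (r₃ + z) (by push_cast; linarith),
    fct_eq_zfact (x := a + c - h + z) (s₁ + z) (by push_cast; linarith),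
    fct_eq_zfact (x := 2 * h - z) (s₂ + s₃ - z) (by push_cast; linarith),
    fct_eq_zfact (x := g + h - k - z) (r₂ - z) (by push_cast; linarith),
    fct_eq_zfact (x := c - a + h - z) (s₃ - z) (by push_cast; linarith), zfact_natCast]

lemma weightSnd_natCast {b c d f k : ℚ} {q₁ q₂ q₃ u₁ u₂ u₃ : ℕ}
    (hq₁ : c + d - f = q₁) (hq₂ : c - d + f = q₂) (hq₃ : -c + d + f = q₃) (hu₁ : b + d - k = u₁)
    (hu₂ : b - d + k = u₂) (hu₃ : -b + d + k = u₃) (z : ℕ) :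
    fct (2 * d - z) * fct (c - d + f + z) /
        ((Nat.factorial z : ℚ) * fct (d - b + k - z) * fct (c + d - f - z) *
          fct (b + d + k + 1 - z)) =
      weightSnd q₁ q₂ q₃ u₁ u₂ u₃ z := by
  rw [weightSnd]
  rw [fct_eq_zfact (x := 2 * d - z) (q₁ + q₃ - z) (by push_cast; linarith),
    fct_eq_zfact (x := c - d + f + z) (q₂ + z) (by push_cast; linarith),
    fct_eq_zfact (x := d - b + k - z) (u₃ - z) (by push_cast; linarith),
    fct_eq_zfact (x := c + d - f - z) (q₁ - z) (by push_cast; linarith),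
    fct_eq_zfact (x := b + d + k + 1 - z) (u₁ + u₂ + u₃ + 1 - z) (by push_cast; linarith),
    zfact_natCast]

lemma weightFst_of_lt {r₂ r₃ s₁ s₂ s₃ z : ℤ} (hz : r₂ < z) : weightFst r₂ r₃ s₁ s₂ s₃ z = 0 := by
  simp [weightFst, zfact_of_neg (show r₂ - z < 0 by omega)]

lemma weightSnd_of_lt {q₁ q₂ q₃ u₁ u₂ u₃ z : ℤ} (hz : u₃ < z) :
    weightSnd q₁ q₂ q₃ u₁ u₂ u₃ z = 0 := by
  simp [weightSnd, zfact_of_neg (show u₃ - z < 0 by omega)]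

lemma sumSA_eq_sum_Icc {a b c d e f g h k : ℚ}
    {p₁ p₂ p₃ q₁ q₂ q₃ r₂ r₃ s₁ s₂ s₃ u₁ u₂ u₃ w₂ w₃ : ℕ}
    (hp₁ : a + b - e = p₁) (hp₂ : a - b + e = p₂) (hp₃ : -a + b + e = p₃) (hq₁ : c + d - f = q₁)
    (hq₂ : c - d + f = q₂) (hq₃ : -c + d + f = q₃) (hr₂ : h - k + g = r₂) (hr₃ : -h + k + g = r₃)
    (hs₁ : a + c - h = s₁) (hs₂ : a - c + h = s₂) (hs₃ : -a + c + h = s₃) (hu₁ : b + d - k = u₁)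
    (hu₂ : b - d + k = u₂) (hu₃ : -b + d + k = u₃) (hw₂ : e - f + g = w₂) (hw₃ : -e + f + g = w₃) :
    sumSA a b c d e f g h k =
      ∑ z₁ ∈ Icc (0 : ℤ) r₂, ∑ z₂ ∈ Icc (0 : ℤ) u₃, ∑ z₃ ∈ Icc (0 : ℤ) p₁,
        (-1 : ℚ) ^ (z₁ + z₂ + z₃) * weightFst r₂ r₃ s₁ s₂ s₃ z₁ *
        weightSnd q₁ q₂ q₃ u₁ u₂ u₃ z₂ *
        (zfact (p₃ + z₃) * zfact (w₂ + z₃) /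
          (zfact z₃ * zfact (p₁ - z₃) * zfact (w₃ - z₃) * zfact (p₂ + p₃ + 1 + z₃))) *
        (zfact (p₁ + u₃ - z₂ - z₃) /
          (zfact (s₁ - q₁ + z₁ + z₂) * zfact (w₂ - r₂ + z₁ + z₃))) := by
  refine finsum_natCast_eq_sum_Icc _ r₂ (fun z₁ => ?_)
    fun z hz => by simp [weightFst_of_lt hz]
  refine finsum_natCast_eq_sum_Icc _ u₃ (fun z₂ => ?_)
    fun z hz => by simp [weightSnd_of_lt hz]
  refine finsum_natCast_eq_sum_Icc _ p₁ (fun z₃ => ?_)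
    fun z hz => by simp [zfact_of_neg (show p₁ - z < 0 by omega)]
  rw [weightFst_natCast hr₂ hr₃ hs₁ hs₂ hs₃,
      weightSnd_natCast hq₁ hq₂ hq₃ hu₁ hu₂ hu₃, ← zfact_natCast z₃,
    fct_eq_zfact (x := b + e - a + z₃) (p₃ + z₃) (by push_cast; linarith),
    fct_eq_zfact (x := e - f + g + z₃) (w₂ + z₃) (by push_cast; linarith),
    fct_eq_zfact (x := a + b - e - z₃) (p₁ - z₃) (by push_cast; linarith),
    fct_eq_zfact (x := f + g - e - z₃) (w₃ - z₃) (by push_cast; linarith),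
    fct_eq_zfact (x := 2 * e + 1 + z₃) (p₂ + p₃ + 1 + z₃) (by push_cast; linarith),
    fct_eq_zfact (x := a + d - e + k - z₂ - z₃) (p₁ + u₃ - z₂ - z₃) (by push_cast; linarith),
    fct_eq_zfact (x := a - d + f - h + z₁ + z₂) (s₁ - q₁ + z₁ + z₂) (by push_cast; linarith),
    fct_eq_zfact (x := e - f - h + k + z₁ + z₃) (w₂ - r₂ + z₁ + z₃) (by push_cast; linarith)]
  norm_cast

lemma sumSE_eq_sum_Icc {a b c d e f g h k : ℚ}
    {p₁ p₂ p₃ q₁ q₂ q₃ r₂ r₃ s₁ s₂ s₃ u₁ u₂ u₃ w₁ w₂ w₃ : ℕ}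
    (hp₁ : a + b - e = p₁) (hp₂ : a - b + e = p₂) (hp₃ : -a + b + e = p₃) (hq₁ : c + d - f = q₁)
    (hq₂ : c - d + f = q₂) (hq₃ : -c + d + f = q₃) (hr₂ : h - k + g = r₂) (hr₃ : -h + k + g = r₃)
    (hs₁ : a + c - h = s₁) (hs₂ : a - c + h = s₂) (hs₃ : -a + c + h = s₃) (hu₁ : b + d - k = u₁)
    (hu₂ : b - d + k = u₂) (hu₃ : -b + d + k = u₃) (hw₁ : e + f - g = w₁) (hw₂ : e - f + g = w₂)
    (hw₃ : -e + f + g = w₃) :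
    sumSE a b c d e f g h k =
      ∑ z₁ ∈ Icc (0 : ℤ) r₂, ∑ z₂ ∈ Icc (0 : ℤ) u₃, ∑ z₃ ∈ Icc (0 : ℤ) p₂,
        (-1 : ℚ) ^ (z₂ + z₃) * weightFst r₂ r₃ s₁ s₂ s₃ z₁ *
        weightSnd q₁ q₂ q₃ u₁ u₂ u₃ z₂ *
        (zfact (p₂ + p₃ - z₃) /
          (zfact z₃ * zfact (p₂ - z₃) * zfact (w₁ - z₃) * zfact (w₁ + w₂ + w₃ + 1 - z₃))) *
        (zfact (p₁ + p₂ + p₃ + u₃ + 1 - z₂ - z₃) * zfact (w₁ + r₂ - z₁ - z₃) /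
          (zfact (p₁ + p₂ + p₃ + 1 - z₃) * zfact (s₁ - q₁ + z₁ + z₂))) := by
  refine finsum_natCast_eq_sum_Icc _ r₂ (fun z₁ => ?_)
    fun z hz => by simp [weightFst_of_lt hz]
  refine finsum_natCast_eq_sum_Icc _ u₃ (fun z₂ => ?_)
    fun z hz => by simp [weightSnd_of_lt hz]
  refine finsum_natCast_eq_sum_Icc _ p₂ (fun z₃ => ?_)
    fun z hz => by simp [zfact_of_neg (show p₂ - z < 0 by omega)]
  rw [show k + g - h + z₁ = g - h + k + z₁ by ring,
      weightFst_natCast hr₂ hr₃ hs₁ hs₂ hs₃,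
      weightSnd_natCast hq₁ hq₂ hq₃ hu₁ hu₂ hu₃, ← zfact_natCast z₃,
    fct_eq_zfact (x := 2 * e - z₃) (p₂ + p₃ - z₃) (by push_cast; linarith),
    fct_eq_zfact (x := a - b + e - z₃) (p₂ - z₃) (by push_cast; linarith),
    fct_eq_zfact (x := e + f - g - z₃) (w₁ - z₃) (by push_cast; linarith),
    fct_eq_zfact (x := e + f + g + 1 - z₃) (w₁ + w₂ + w₃ + 1 - z₃) (by push_cast; linarith),
    fct_eq_zfact (x := a + d + e + k + 1 - z₂ - z₃) (p₁ + p₂ + p₃ + u₃ + 1 - z₂ - z₃)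
      (by push_cast; linarith),
    fct_eq_zfact (x := e + f + h - k - z₁ - z₃) (w₁ + r₂ - z₁ - z₃) (by push_cast; linarith),
    fct_eq_zfact (x := a + b + e + 1 - z₃) (p₁ + p₂ + p₃ + 1 - z₃) (by push_cast; linarith),
    fct_eq_zfact (x := a - d + f - h + z₁ + z₂) (s₁ - q₁ + z₁ + z₂) (by push_cast; linarith)]
  norm_cast

end

/-- Equality of the Ališauskas–Jucys triple-sum formula for the SU(2) 9j
coefficient `{a b e; c d f; h k g}` and the new triple-sum formula obtained from
expansion (trse) of the paper. -/
theorem nineJ_tripleSum_A_eq_E (a b c d e f g h k : ℚ)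
    (ha : IsNNHalfInt a) (hb : IsNNHalfInt b) (hc : IsNNHalfInt c)
    (hd : IsNNHalfInt d) (he : IsNNHalfInt e) (hf : IsNNHalfInt f)
    (hg : IsNNHalfInt g) (hh : IsNNHalfInt h) (hk : IsNNHalfInt k)
    (t1 : Triad a b e) (t2 : Triad c d f) (t3 : Triad h k g)
    (t4 : Triad a c h) (t5 : Triad b d k) (t6 : Triad e f g) :
    neg1pw (c + h - a) * sumSA a b c d e f g h k =
      neg1pw (c - b + e - g + k) * sumSE a b c d e f g h k := by
  obtain ⟨⟨p₁, hp₁⟩, ⟨p₂, hp₂⟩, ⟨p₃, hp₃⟩⟩ := t1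
  obtain ⟨⟨q₁, hq₁⟩, ⟨q₂, hq₂⟩, ⟨q₃, hq₃⟩⟩ := t2
  obtain ⟨⟨r₁, hr₁⟩, ⟨r₂, hr₂⟩, ⟨r₃, hr₃⟩⟩ := t3
  obtain ⟨⟨s₁, hs₁⟩, ⟨s₂, hs₂⟩, ⟨s₃, hs₃⟩⟩ := t4
  obtain ⟨⟨u₁, hu₁⟩, ⟨u₂, hu₂⟩, ⟨u₃, hu₃⟩⟩ := t5
  obtain ⟨⟨w₁, hw₁⟩, ⟨w₂, hw₂⟩, ⟨w₃, hw₃⟩⟩ := t6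
  have ea : p₁ + p₂ = s₁ + s₂ := by
    have : (p₁ : ℚ) + p₂ = s₁ + s₂ := by linarith
    exact_mod_cast this
  have eb : p₁ + p₃ = u₁ + u₂ := by
    have : (p₁ : ℚ) + p₃ = u₁ + u₂ := by linarith
    exact_mod_cast this
  have ec : q₁ + q₂ = s₁ + s₃ := by
    have : (q₁ : ℚ) + q₂ = s₁ + s₃ := by linarith
    exact_mod_cast this
  have ed : q₁ + q₃ = u₁ + u₃ := by
    have : (q₁ : ℚ) + q₃ = u₁ + u₃ := by linarith
    exact_mod_cast this
  have ee : p₂ + p₃ = w₁ + w₂ := by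
    have : (p₂ : ℚ) + p₃ = w₁ + w₂ := by linarith
    exact_mod_cast this
  have ef : q₂ + q₃ = w₁ + w₃ := by
    have : (q₂ : ℚ) + q₃ = w₁ + w₃ := by linarith
    exact_mod_cast this
  have eg : r₂ + r₃ = w₂ + w₃ := by
    have : (r₂ : ℚ) + r₃ = w₂ + w₃ := by linarith
    exact_mod_cast this
  have eh : r₁ + r₂ = s₂ + s₃ := by
    have : (r₁ : ℚ) + r₂ = s₂ + s₃ := by linarith
    exact_mod_cast this
  have ek : r₁ + r₃ = u₂ + u₃ := by
    have : (r₁ : ℚ) + r₃ = u₂ + u₃ := by linarith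
    exact_mod_cast this
  have hsA : neg1pw (c + h - a) = (-1 : ℚ) ^ (s₃ : ℤ) := by
    rw [neg1pw, show c + h - a = ((s₃ : ℤ) : ℚ) by push_cast; linarith, Rat.num_intCast]
  have hsE : neg1pw (c - b + e - g + k) = (-1 : ℚ) ^ (s₃ : ℤ) * (-1) ^ ((p₂ : ℤ) + r₂) := by
    rw [neg1pw, show c - b + e - g + k = ((s₃ + (p₂ + r₂) - 2 * r₂ : ℤ) : ℚ) by
      push_cast; linarith, Rat.num_intCast, zpow_sub₀ (by norm_num), zpow_add₀ (by norm_num),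
      zpow_mul]
    norm_num
  rw [hsA, hsE,
    sumSA_eq_sum_Icc hp₁ hp₂ hp₃ hq₁ hq₂ hq₃ hr₂ hr₃ hs₁ hs₂ hs₃ hu₁ hu₂ hu₃ hw₂ hw₃,
    sumSE_eq_sum_Icc hp₁ hp₂ hp₃ hq₁ hq₂ hq₃ hr₂ hr₃ hs₁ hs₂ hs₃ hu₁ hu₂ hu₃ hw₁ hw₂ hw₃,
    mul_assoc]
  congr 1
  exact sum_sum_sum_weight_eq ea eb ec ed ee ef eg eh ek
end
end

section
/- Define the double sums S1 = Σ_{s,z} (−1)^(s+z) · (a−c+h+s)! (k−b+d+z)! (h+k−e−f+s+z)! / [s!(a+c−h−s)!(b−c−e+h+s)!(2h+1+s)! · z!(b+d−k−z)!(k−b+c−f+z)!(2k+1+z)!] and S1' = Σ_{s,z} (−1)^s · (2h−s)! (c+e+h−b−s)! (k−b+d+z)! / [s!(c+h−a−s)!(a+c+h+1−s)!(e+f+h−k−s−z)! · z!(b+d−k−z)!(c−b−f+k+z)!(2k+1+z)!]. Then, under the triangle conditions of the stretched 9j symbol {a b e; c d f; h k e+f}, S1 = (−1)^(b−a+f+h−k)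 · S1' (the exponent is an integer). These are two of the double-sum expressions for the stretched SU(2) 9j coefficient with g = e+f, which share the same prefactor, so their sums agree up to the indicated sign. -/
noncomputable section

/-- The double sum `S1` of the expression (stra) for the stretched 9j
coefficient `{a b e; c d f; h k e+f}`. -/
def sumS1 (a b c d e f h k : ℚ) : ℚ :=
  ∑ᶠ s : ℕ, ∑ᶠ z : ℕ,
    (-1 : ℚ) ^ (s + z) *
      fct (a - c + h + s) * fct (k - b + d + z) * fct (h + k - e - f + s + z) /
      ((Nat.factorial s : ℚ) * fct (a + c - h - s) * fct (b - c - e + h + s) *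
        fct (2 * h + 1 + s) * (Nat.factorial z : ℚ) * fct (b + d - k - z) *
        fct (k - b + c - f + z) * fct (2 * k + 1 + z))

/-- The double sum `S1'` of the expression (strb) for the stretched 9j
coefficient `{a b e; c d f; h k e+f}`. -/
def sumS1' (a b c d e f h k : ℚ) : ℚ :=
  ∑ᶠ s : ℕ, ∑ᶠ z : ℕ,
    (-1 : ℚ) ^ s *
      fct (2 * h - s) * fct (c + e + h - b - s) * fct (k - b + d + z) /
      ((Nat.factorial s : ℚ) * fct (c + h - a - s) * fct (a + c + h + 1 - s) *
        fct (e + f + h - k - s - z) * (Nat.factorial z : ℚ) * fct (b + d - k - z) *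
        fct (c - b - f + k + z) * fct (2 * k + 1 + z))

open Finset in
/-- The nodal weight of the consecutive nodes `0, …, s + t` at the node `s`. -/
lemma prod_erase_range_sub (s t : ℕ) :
    ∏ m ∈ (range (s + t + 1)).erase s, ((s : ℚ) - m) =
      (-1) ^ t * s.factorial * t.factorial := by
  induction t with
  | zero =>
    have h : (range (s + 0 + 1)).erase s = range s := by
      ext x; simp only [mem_erase, mem_range]; omega
    rw [h, ← prod_range_reflect, ← prod_range_add_one_eq_factorial]
    simp only [pow_zero, one_mul, Nat.factorial_zero, Nat.cast_one, mul_one, Nat.cast_prod]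
    refine prod_congr rfl fun i hi => ?_
    rw [mem_range] at hi
    obtain ⟨j, rfl⟩ := Nat.exists_eq_add_of_lt hi
    rw [show i + j + 1 - 1 - i = j by omega]
    push_cast
    ring
  | succ t ih =>
    have h : (range (s + (t + 1) + 1)).erase s =
        insert (s + t + 1) ((range (s + t + 1)).erase s) := by
      ext x; simp only [mem_erase, mem_range, mem_insert]; omega
    rw [h, prod_insert (by simp), ih, Nat.factorial_succ]
    push_cast
    ring

open Finset in
/-- A product of consecutive integers as a quotient of factorials. -/
lemma prod_range_add_eq_div (n p : ℕ) :
    ∏ i ∈ range p, ((n : ℚ) + 1 + i) = (n + p).factorial / n.factorial := by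
  rw [eq_div_iff (by positivity)]
  induction p with
  | zero => simp
  | succ p ih =>
    rw [prod_range_succ, mul_right_comm, ih, ← add_assoc, Nat.factorial_succ]
    push_cast
    ring

open Finset Polynomial in
/-- The sum of the residues of `Q(x) / (∏_{m ≤ N} (x - m) ∏_{j < M} (x + q + 1 + j))` vanishes
when `deg Q < N + M`. -/
lemma sum_eval_eq_sum_eval_neg (N M q : ℕ) (Q : ℚ[X]) (hQ : Q.degree < (N + M : ℕ)) :
    ∑ s ∈ range (N + 1), (-1) ^ s * Q.eval (s : ℚ) * (q + s).factorial /
        (s.factorial * (N - s).factorial * (q + M + s).factorial) =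
      ∑ j ∈ range M, (-1) ^ j * Q.eval (-((q : ℚ) + 1 + j)) * (q + j).factorial /
        (j.factorial * (M - 1 - j).factorial * (q + j + N + 1).factorial) := by
  classical
  let v : ℕ ⊕ ℕ → ℚ := Sum.elim (fun s => (s : ℚ)) (fun j => -((q : ℚ) + 1 + j))
  set S : Finset (ℕ ⊕ ℕ) := (range (N + 1)).disjSum (range M) with hS
  have hv : Set.InjOn v S := by
    rintro (x | x) - (y | y) - hxy <;> simp only [v, Sum.elim_inl, Sum.elim_inr] at hxy
    · exact congrArg _ (by exact_mod_cast hxy)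
    · exfalso
      have : (0 : ℚ) ≤ x := by positivity
      have : (0 : ℚ) < (q : ℚ) + 1 + y := by positivity
      linarith
    · exfalso
      have : (0 : ℚ) ≤ y := by positivity
      have : (0 : ℚ) < (q : ℚ) + 1 + x := by positivity
      linarith
    · have : (x : ℚ) = y := by linarith
      exact congrArg _ (by exact_mod_cast this)
  have hcard : S.card = N + M + 1 := by simp [hS]; omega
  have key := Lagrange.coeff_eq_sum hv (P := Q) (hQ.trans (by
    rw [hcard]; exact_mod_cast Nat.lt_succ_self _))
  rw [hcard, Nat.add_sub_cancel, coeff_eq_zero_of_degree_lt hQ, hS, sum_disjSum] at key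
  have h1 : ∀ s ∈ range (N + 1), Q.eval (v (Sum.inl s)) /
      ∏ j ∈ ((range (N + 1)).disjSum (range M)).erase (Sum.inl s), (v (Sum.inl s) - v j) =
      (-1) ^ N * ((-1) ^ s * Q.eval (s : ℚ) * (q + s).factorial /
        (s.factorial * (N - s).factorial * (q + M + s).factorial)) := by
    intro s hs
    obtain ⟨t, rfl⟩ : ∃ t, N = s + t := Nat.exists_eq_add_of_le (by simpa [Nat.lt_succ_iff] using hs)
    have he : ((range (s + t + 1)).disjSum (range M)).erase (Sum.inl s) =
        ((range (s + t + 1)).erase s).disjSum (range M) := by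
      ext (x | x) <;> simp
    have hp : ∏ j ∈ range M, (v (Sum.inl s) - v (Sum.inr j)) =
        (q + M + s).factorial / (q + s).factorial := by
      rw [show q + M + s = q + s + M by ring, ← prod_range_add_eq_div]
      refine prod_congr rfl fun i _ => ?_
      simp only [v, Sum.elim_inl, Sum.elim_inr]; push_cast; ring
    have hp' : ∏ j ∈ (range (s + t + 1)).erase s, (v (Sum.inl s) - v (Sum.inl j)) = _ :=
      prod_erase_range_sub s t
    rw [he, prod_disjSum, hp, hp', Nat.add_sub_cancel_left]
    simp only [v, Sum.elim_inl]
    have ht : ((-1 : ℚ) ^ t)⁻¹ = (-1) ^ t := by rw [← inv_pow]; norm_num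
    have hs2 : ((-1 : ℚ) ^ s) * (-1) ^ s = 1 := by rw [← mul_pow]; norm_num
    rw [pow_add]
    simp only [div_eq_mul_inv, mul_inv, ht, inv_inv]
    linear_combination (-(-1 : ℚ) ^ t * Q.eval (s : ℚ) * ((q + s).factorial : ℚ) *
      (s.factorial : ℚ)⁻¹ * (t.factorial : ℚ)⁻¹ * ((q + M + s).factorial : ℚ)⁻¹) * hs2
  have h2 : ∀ j ∈ range M, Q.eval (v (Sum.inr j)) /
      ∏ i ∈ ((range (N + 1)).disjSum (range M)).erase (Sum.inr j), (v (Sum.inr j) - v i) =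
      -(-1) ^ N * ((-1) ^ j * Q.eval (-((q : ℚ) + 1 + j)) * (q + j).factorial /
        (j.factorial * (M - 1 - j).factorial * (q + j + N + 1).factorial)) := by
    intro j hj
    obtain ⟨t, rfl⟩ : ∃ t, M = j + t + 1 := Nat.exists_eq_add_of_lt (by simpa using hj)
    have he : ((range (N + 1)).disjSum (range (j + t + 1))).erase (Sum.inr j) =
        (range (N + 1)).disjSum ((range (j + t + 1)).erase j) := by
      ext (x | x) <;> simp
    have hp : ∏ m ∈ range (N + 1), (v (Sum.inr j) - v (Sum.inl m)) =
        (-1) ^ (N + 1) * ((q + j + N + 1).factorial / (q + j).factorial) := by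
      rw [show q + j + N + 1 = q + j + (N + 1) by ring, ← prod_range_add_eq_div]
      nth_rewrite 2 [← card_range (N + 1)]
      rw [← prod_neg]
      refine prod_congr rfl fun i _ => ?_
      simp only [v, Sum.elim_inl, Sum.elim_inr]; push_cast; ring
    have hp' : ∏ i ∈ (range (j + t + 1)).erase j, (v (Sum.inr j) - v (Sum.inr i)) =
        (-1) ^ (j + t) * ((-1) ^ t * j.factorial * t.factorial) := by
      have hc : ((range (j + t + 1)).erase j).card = j + t := by
        rw [card_erase_of_mem hj]; simp
      rw [← prod_erase_range_sub, show (-1 : ℚ) ^ (j + t) = (-1) ^ ((range (j + t + 1)).erase j).card by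
        rw [hc], ← prod_neg]
      refine prod_congr rfl fun i _ => ?_
      simp only [v, Sum.elim_inr]; ring
    rw [he, prod_disjSum, hp, hp', show j + t + 1 - 1 - j = t by omega]
    simp only [v, Sum.elim_inr]
    have hi : ∀ n : ℕ, ((-1 : ℚ) ^ n)⁻¹ = (-1) ^ n := fun n => by rw [← inv_pow]; norm_num
    have ht : ((-1 : ℚ) ^ t) * (-1) ^ t = 1 := by rw [← mul_pow]; norm_num
    rw [pow_add (-1 : ℚ) j t, pow_succ]
    simp only [div_eq_mul_inv, mul_inv, hi, inv_inv]
    linear_combination (-(-1 : ℚ) ^ N * (-1) ^ j * Q.eval (-((q : ℚ) + 1 + j)) *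
      ((q + j).factorial : ℚ) * (j.factorial : ℚ)⁻¹ * (t.factorial : ℚ)⁻¹ *
      ((q + j + N + 1).factorial : ℚ)⁻¹) * ht
  rw [sum_congr rfl h1, sum_congr rfl h2, ← mul_sum, ← mul_sum] at key
  have hN : ((-1 : ℚ) ^ N) ≠ 0 := by positivity
  refine mul_left_cancel₀ hN ?_
  linear_combination -key

lemma fct_natCast (n : ℕ) : fct n = n.factorial := by simp [fct]

lemma fct_of_neg {x : ℚ} (h : x < 0) : fct x = 0 := by
  rw [fct, if_neg]; exact fun h' => absurd h'.1 (not_le.mpr h)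

open Finset in
/-- A product of consecutive integers ending in a nonnegative one, as a quotient of factorials. -/
lemma prod_range_add_eq_fct_div (x : ℤ) (p : ℕ) (h : 0 ≤ x + p) :
    ∏ i ∈ range p, ((x : ℚ) + 1 + i) = fct (x + p) / fct x := by
  obtain ⟨n, rfl⟩ | hx : (∃ n : ℕ, x = n) ∨ x < 0 := by
    rcases lt_or_ge x 0 with h | h
    · exact Or.inr h
    · exact Or.inl ⟨x.toNat, by omega⟩
  · rw [Int.cast_natCast, prod_range_add_eq_div, fct_natCast, ← Nat.cast_add, fct_natCast]
  · rw [fct_of_neg (x := (x : ℚ)) (by exact_mod_cast hx), div_zero]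
    refine prod_eq_zero (i := (-x - 1).toNat) (by simp; omega) ?_
    have : ((-x - 1).toNat : ℤ) = -x - 1 := by omega
    have : (((-x - 1).toNat : ℤ) : ℚ) = -x - 1 := by rw [this]; push_cast; ring
    rw [Int.cast_natCast] at this
    rw [this]; ring

open Finset Polynomial in
lemma degree_prod_X_add_C (c : ℚ) (p : ℕ) :
    (∏ i ∈ range p, (X + C (c + 1 + (i : ℚ)))).degree = (p : WithBot ℕ) := by
  simp only [degree_prod, degree_X_add_C]
  simp

open Finset in
/-- A transformation of terminating alternating `₃F₂`-type sums of factorials. -/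
lemma sum_factorial_transform (N α γ q p : ℕ) (h1 : α ≤ q + p) (h2 : p + q ≤ N + α + γ) :
    ∑ s ∈ range (N + 1), (-1 : ℚ) ^ s * (α + s).factorial * (q + s).factorial /
        (s.factorial * (N - s).factorial * fct (α - p + s) * (α + γ + 1 + s).factorial) =
      (-1) ^ (p + α + γ + q) * ∑ s ∈ range (α + γ + 1),
        (-1 : ℚ) ^ s * (α + γ - s).factorial * fct (γ + p - s) /
        (s.factorial * fct (γ - s) * (N + α + γ + 1 - s).factorial * fct (α + γ - q - s)) := by
  have hP : ∀ s : ℕ, ∏ i ∈ range p, ((s : ℚ) + (((α : ℚ) - p) + 1 + i)) =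
      (α + s).factorial / fct (α - p + s) := by
    intro s
    have := prod_range_add_eq_fct_div ((α : ℤ) - p + s) p (by omega)
    push_cast at this
    rw [show (α : ℚ) - p + s + p = ((α + s : ℕ) : ℚ) by push_cast; ring, fct_natCast] at this
    rw [← this]
    exact prod_congr rfl fun i _ => by ring
  rcases le_or_gt q (α + γ) with hq | hq
  · obtain ⟨r, hr⟩ := Nat.exists_eq_add_of_le hq
    have hd : (∏ i ∈ range p, (Polynomial.X + Polynomial.C (((α : ℚ) - p) + 1 + (i : ℚ)))).degree <
        ((N + (r + 1) : ℕ) : WithBot ℕ) := by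
      rw [degree_prod_X_add_C]; exact_mod_cast (by omega : p < N + (r + 1))
    have key := sum_eval_eq_sum_eval_neg N (r + 1) q _ hd
    simp only [Polynomial.eval_prod, Polynomial.eval_add, Polynomial.eval_X, Polynomial.eval_C,
      hP] at key
    have hL : ∀ s ∈ range (N + 1), (-1 : ℚ) ^ s * (α + s).factorial * (q + s).factorial /
        (s.factorial * (N - s).factorial * fct (α - p + s) * (α + γ + 1 + s).factorial) =
        (-1) ^ s * ((α + s).factorial / fct (α - p + s)) * (q + s).factorial /
          (s.factorial * (N - s).factorial * (q + (r + 1) + s).factorial) := by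
      intro s _
      rw [show q + (r + 1) + s = α + γ + 1 + s by omega]
      simp only [div_eq_mul_inv, mul_inv]
      ring
    rw [sum_congr rfl hL, key, ← sum_range_reflect, mul_sum,
      ← sum_subset (range_mono (by omega : r + 1 ≤ α + γ + 1))]
    · refine sum_congr rfl fun s hs => ?_
      rw [mem_range] at hs
      obtain ⟨j, rfl⟩ : ∃ j, r = s + j := Nat.exists_eq_add_of_le (by omega)
      have hQ : (α : ℚ) + γ = q + (s + j) := by exact_mod_cast hr
      have hprod : ∏ i ∈ range p, (-((q : ℚ) + 1 + j) + (((α : ℚ) - p) + 1 + i)) =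
          (-1) ^ p * (fct (γ + p - s) / fct (γ - s)) := by
        have := prod_range_add_eq_fct_div ((γ : ℤ) - s) p (by omega)
        push_cast at this
        rw [show (γ : ℚ) + p - s = γ - s + p by ring, ← this, ← prod_range_reflect]
        conv_rhs => rw [show (-1 : ℚ) ^ p = (-1) ^ (range p).card by rw [card_range], ← prod_neg]
        refine prod_congr rfl fun i hi => ?_
        rw [mem_range] at hi
        obtain ⟨l, hl⟩ := Nat.exists_eq_add_of_lt hi
        rw [show p - 1 - i = l by omega, hl]
        push_cast
        linear_combination hQ
      rw [show s + j + 1 - 1 - s = j by omega, show s + j + 1 - 1 - j = s by omega, hprod,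
        show q + j + N + 1 = N + α + γ + 1 - s by omega, show q + j = α + γ - s by omega,
        show (α : ℚ) + γ - q - s = j by rw [hQ]; ring, fct_natCast,
        show p + α + γ + q = p + 2 * q + s + j by omega]
      have hs2 : ((-1 : ℚ) ^ s) * (-1) ^ s = 1 := by rw [← mul_pow]; norm_num
      rw [pow_add, pow_add, pow_add, pow_mul, neg_one_sq, one_pow]
      simp only [div_eq_mul_inv, mul_inv]
      linear_combination (-(-1 : ℚ) ^ p * (-1) ^ j * (α + γ - s).factorial * fct (γ + p - s) *
        (s.factorial : ℚ)⁻¹ * (fct (γ - s))⁻¹ * ((N + α + γ + 1 - s).factorial : ℚ)⁻¹ *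
        (j.factorial : ℚ)⁻¹) * hs2
    · intro s _ hs
      have : (α : ℚ) + γ < q + s := by
        rw [mem_range] at hs
        exact_mod_cast (by omega : α + γ < q + s)
      rw [fct_of_neg (x := (α : ℚ) + γ - q - s) (by linarith)]
      simp
  · obtain ⟨u, rfl⟩ := Nat.exists_eq_add_of_lt hq
    have hd : ((∏ i ∈ range p, (Polynomial.X + Polynomial.C (((α : ℚ) - p) + 1 + (i : ℚ)))) *
        ∏ i ∈ range u, (Polynomial.X + Polynomial.C (((α + γ + 1 : ℕ) : ℚ) + 1 + (i : ℚ)))).degree <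
        ((N + 0 : ℕ) : WithBot ℕ) := by
      rw [Polynomial.degree_mul, degree_prod_X_add_C, degree_prod_X_add_C]
      exact_mod_cast (by omega : p + u < N + 0)
    have key := sum_eval_eq_sum_eval_neg N 0 0 _ hd
    simp only [Polynomial.eval_mul, Polynomial.eval_prod, Polynomial.eval_add, Polynomial.eval_X,
      Polynomial.eval_C, hP, range_zero, sum_empty] at key
    trans 0
    · rw [← key]
      refine sum_congr rfl fun s _ => ?_
      have hu : ∏ i ∈ range u, ((s : ℚ) + (((α + γ + 1 : ℕ) : ℚ) + 1 + i)) =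
          (α + γ + u + 1 + s).factorial / (α + γ + 1 + s).factorial := by
        rw [show α + γ + u + 1 + s = α + γ + 1 + s + u by ring, ← prod_range_add_eq_div]
        exact prod_congr rfl fun i _ => by push_cast; ring
      rw [hu, zero_add, zero_add, zero_add]
      have : ((s.factorial : ℚ)) ≠ 0 := by positivity
      simp only [div_eq_mul_inv, mul_inv]
      field_simp
    · rw [sum_eq_zero, mul_zero]
      intro s _
      have : (0 : ℚ) ≤ s := by positivity
      have : (0 : ℚ) ≤ u := by positivity
      rw [fct_of_neg (x := (α : ℚ) + γ - _ - s) (by push_cast; linarith)]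
      simp

lemma fct_natCast_sub {m n : ℕ} (h : n ≤ m) : fct ((m : ℚ) - n) = (m - n).factorial := by
  rw [← Nat.cast_sub h, fct_natCast]

lemma fct_natCast_sub_of_lt {m n : ℕ} (h : m < n) : fct ((m : ℚ) - n) = 0 :=
  fct_of_neg (sub_neg.mpr (by exact_mod_cast h))

open Finset in
lemma finsum_finsum_eq_sum_sum (F : ℕ → ℕ → ℚ) (m n : ℕ) (hm : ∀ s z, m ≤ s → F s z = 0)
    (hn : ∀ s z, n ≤ z → F s z = 0) :
    ∑ᶠ s : ℕ, ∑ᶠ z : ℕ, F s z = ∑ z ∈ range n, ∑ s ∈ range m, F s z := by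
  have hz : ∀ s, ∑ᶠ z : ℕ, F s z = ∑ z ∈ range n, F s z := fun s =>
    finsum_eq_sum_of_support_subset _ fun z h => by
      by_contra h'
      exact h (hn s z (by simpa using h'))
  simp only [hz]
  rw [sum_comm]
  refine finsum_eq_sum_of_support_subset _ fun s h => ?_
  by_contra h'
  exact h (sum_eq_zero fun z _ => hm s z (by simpa using h'))

/-- Equality, up to sign, of two double-sum expressions for the stretched SU(2)
9j coefficient `{a b e; c d f; h k e+f}` (with `g = e + f`). -/
theorem stretched_nineJ_S1_eq_S1' (a b c d e f h k : ℚ)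
    (ha : IsNNHalfInt a) (hb : IsNNHalfInt b) (hc : IsNNHalfInt c)
    (hd : IsNNHalfInt d) (he : IsNNHalfInt e) (hf : IsNNHalfInt f)
    (hh : IsNNHalfInt h) (hk : IsNNHalfInt k)
    (t1 : Triad a b e) (t2 : Triad c d f) (t3 : Triad h k (e + f))
    (t4 : Triad a c h) (t5 : Triad b d k) :
    sumS1 a b c d e f h k =
      neg1pw (b - a + f + h - k) * sumS1' a b c d e f h k := by
  obtain ⟨-, ⟨p, hp⟩, -⟩ := t1
  obtain ⟨-, ⟨n, hn⟩, -⟩ := t2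
  obtain ⟨⟨q, hq⟩, -, -⟩ := t3
  obtain ⟨⟨N, hN⟩, ⟨α, hα⟩, ⟨γ, hγ⟩⟩ := t4
  obtain ⟨⟨Z, hZ⟩, -, -⟩ := t5
  have hsign : neg1pw (b - a + f + h - k) = (-1) ^ (p + α + γ + q) := by
    have h1 : b - a + f + h - k = (((p + α + γ + q : ℕ) - 2 * (p + q : ℕ) : ℤ) : ℚ) := by
      push_cast
      linarith
    rw [neg1pw, h1, Rat.num_intCast, zpow_sub₀ (by norm_num), zpow_natCast, zpow_mul]
    norm_num
  have hL : ∀ s z : ℕ, (-1 : ℚ) ^ (s + z) *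
      fct (a - c + h + s) * fct (k - b + d + z) * fct (h + k - e - f + s + z) /
      ((Nat.factorial s : ℚ) * fct (a + c - h - s) * fct (b - c - e + h + s) *
        fct (2 * h + 1 + s) * (Nat.factorial z : ℚ) * fct (b + d - k - z) *
        fct (k - b + c - f + z) * fct (2 * k + 1 + z)) =
      (-1) ^ z * (fct (k - b + d + z) / (z.factorial * fct (Z - z) * fct (k - b + c - f + z) *
        fct (2 * k + 1 + z))) *
      ((-1 : ℚ) ^ s * (α + s).factorial * (q + z + s).factorial /
        (s.factorial * fct (N - s) * fct (α - p + s) * (α + γ + 1 + s).factorial)) := by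
    intro s z
    rw [show a - c + h + s = ((α + s : ℕ) : ℚ) by push_cast; linarith,
      show h + k - e - f + s + z = ((q + z + s : ℕ) : ℚ) by push_cast; linarith,
      show 2 * h + 1 + s = ((α + γ + 1 + s : ℕ) : ℚ) by push_cast; linarith,
      hN, hZ, show b - c - e + h + s = (α : ℚ) - p + s by linarith,
      fct_natCast, fct_natCast, fct_natCast, pow_add]
    simp only [div_eq_mul_inv, mul_inv]
    ring
  have hR : ∀ s z : ℕ, (-1 : ℚ) ^ s *
      fct (2 * h - s) * fct (c + e + h - b - s) * fct (k - b + d + z) /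
      ((Nat.factorial s : ℚ) * fct (c + h - a - s) * fct (a + c + h + 1 - s) *
        fct (e + f + h - k - s - z) * (Nat.factorial z : ℚ) * fct (b + d - k - z) *
        fct (c - b - f + k + z) * fct (2 * k + 1 + z)) =
      (fct (k - b + d + z) / (z.factorial * fct (Z - z) * fct (k - b + c - f + z) *
        fct (2 * k + 1 + z))) *
      ((-1 : ℚ) ^ s * fct ((α + γ : ℕ) - s) * fct (γ + p - s) /
        (s.factorial * fct (γ - s) * fct ((N + α + γ + 1 : ℕ) - s) *
          fct (α + γ - (q + z : ℕ) - s))) := by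
    intro s z
    rw [show 2 * h - s = ((α + γ : ℕ) : ℚ) - s by push_cast; linarith,
      show c + e + h - b - s = (γ : ℚ) + p - s by linarith,
      show c + h - a - s = (γ : ℚ) - s by linarith,
      show a + c + h + 1 - s = ((N + α + γ + 1 : ℕ) : ℚ) - s by push_cast; linarith,
      show e + f + h - k - s - z = (α : ℚ) + γ - (q + z : ℕ) - s by push_cast; linarith,
      hZ, show c - b - f + k + z = k - b + c - f + z by ring]
    simp only [div_eq_mul_inv, mul_inv]
    ring
  simp only [sumS1, sumS1', hL, hR]
  rw [finsum_finsum_eq_sum_sum _ (N + 1) (Z + 1), finsum_finsum_eq_sum_sum _ (α + γ + 1) (Z + 1),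
    hsign, Finset.mul_sum]
  · refine Finset.sum_congr rfl fun z hz => ?_
    rw [← Finset.mul_sum, ← Finset.mul_sum]
    by_cases hδ : k - b + c - f + z < 0
    · simp [fct_of_neg hδ]
    have hz' : z ≤ Z := by simpa [Nat.lt_succ_iff] using hz
    have h1 : α ≤ q + z + p := by
      have : (α : ℚ) ≤ q + z + p := by linarith
      exact_mod_cast this
    have h2 : p + (q + z) ≤ N + α + γ := by
      have h3 : (z : ℚ) ≤ Z := by exact_mod_cast hz'
      have h4 : (0 : ℚ) ≤ n := by positivity
      have : (p : ℚ) + (q + z) ≤ N + α + γ := by linarith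
      exact_mod_cast this
    have key := sum_factorial_transform N α γ (q + z) p h1 h2
    have hl : ∀ s ∈ Finset.range (N + 1), fct ((N : ℚ) - s) = (N - s).factorial := fun s hs =>
      fct_natCast_sub (by simpa [Nat.lt_succ_iff] using hs)
    have hr : ∀ s ∈ Finset.range (α + γ + 1),
        fct (((α + γ : ℕ) : ℚ) - s) = (α + γ - s).factorial ∧
        fct (((N + α + γ + 1 : ℕ) : ℚ) - s) = (N + α + γ + 1 - s).factorial := fun s hs => by
      rw [Finset.mem_range] at hs
      exact ⟨fct_natCast_sub (by omega), fct_natCast_sub (by omega)⟩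
    rw [Finset.sum_congr rfl fun s hs => by rw [hl s hs],
      Finset.sum_congr (s₁ := Finset.range (α + γ + 1)) rfl fun s hs => by
        rw [(hr s hs).1, (hr s hs).2], key]
    have hzz : ((-1 : ℚ) ^ z) * (-1) ^ z = 1 := by rw [← mul_pow]; norm_num
    have comb : ∀ E W T : ℚ, (-1) ^ z * W * (E * (-1) ^ z * T) = E * (W * T) := fun E W T => by
      linear_combination E * W * T * hzz
    rw [← add_assoc, pow_add _ (p + α + γ + q) z]
    exact comb _ _ _
  · intro s z hs
    rw [fct_natCast_sub_of_lt (m := γ) (n := s) (by omega)]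
    simp
  · intro s z hz
    rw [fct_natCast_sub_of_lt (m := Z) (n := z) (by omega)]
    simp
  · intro s z hs
    rw [fct_natCast_sub_of_lt (m := N) (n := s) (by omega)]
    simp
  · intro s z hz
    rw [fct_natCast_sub_of_lt (m := Z) (n := z) (by omega)]
    simp
end
end
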